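/- Fix real parameters ω > 0, χ > 0, ζ > 0, C > 0 and set γ = ωχ, μ = γC. Define η(P) = (χ e^{−ω/P} + ζ)/(P + C) and F₂(P) = −χP² + γP + μ − ζP²e^{ω/P} for P > 0, and let β be the unique zero of F₂′(P) = −2χP + γ + ζ e^{ω/P}(ω − 2P). If F₂(β) ≤ 0, then sup_{P > 0} η(P) = ζ/C and this supremum is not attained; if F₂(β) > 0 and α₂ > β is the larger of the two zeros of F₂, then sup_{P > 0} η(P) = max(ζ/C, η(α₂)). -/

import Mathlib

/-- Energy efficiency of one multicast group as a function of its transmit power `P`: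
`η(P) = (χ e^{-ω/P} + ζ)/(P + C)`. -/
noncomputable def eta (ω χ ζ C : ℝ) (P : ℝ) : ℝ :=
  (χ * Real.exp (-ω / P) + ζ) / (P + C)

/-- The auxiliary function `F₂(P) = -χ P² + γ P + μ - ζ P² e^{ω/P}`. -/
noncomputable def F2 (ω χ γ μ ζ : ℝ) (P : ℝ) : ℝ :=
  -χ * P ^ 2 + γ * P + μ - ζ * P ^ 2 * Real.exp (ω / P)

/-- `F₂'(P) = -2χP + γ + ζ e^{ω/P} (ω - 2P)`. -/
noncomputable def F2deriv (ω χ γ ζ : ℝ) (P : ℝ) : ℝ :=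
  -2 * χ * P + γ + ζ * Real.exp (ω / P) * (ω - 2 * P)

open Set Filter Topology

lemma hasDerivAt_exp_div (ω : ℝ) {x : ℝ} (hx : x ≠ 0) :
    HasDerivAt (fun y => Real.exp (ω / y)) (Real.exp (ω / x) * (-ω / x ^ 2)) x := by
  have h := ((hasDerivAt_const x ω).div (hasDerivAt_id x) hx).exp
  simpa using h

lemma hasDerivAt_F2 (ω χ γ μ ζ : ℝ) {x : ℝ} (hx : x ≠ 0) :
    HasDerivAt (F2 ω χ γ μ ζ) (F2deriv ω χ γ ζ x) x := by
  have hsq := hasDerivAt_pow 2 x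
  have h := (((hsq.const_mul (-χ)).add ((hasDerivAt_id x).const_mul γ)).add_const μ).sub
    ((hsq.const_mul ζ).mul (hasDerivAt_exp_div ω hx))
  refine h.congr_deriv ?_
  simp only [F2deriv]
  field_simp
  push_cast
  ring

lemma hasDerivAt_F2deriv (ω χ γ ζ : ℝ) {x : ℝ} (hx : x ≠ 0) :
    HasDerivAt (F2deriv ω χ γ ζ)
      (-2 * χ - ζ * Real.exp (ω / x) * ((x - ω) ^ 2 + x ^ 2) / x ^ 2) x := by
  have h := (((hasDerivAt_id x).const_mul (-2 * χ)).add_const γ).add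
    (((hasDerivAt_exp_div ω hx).const_mul ζ).mul
      (((hasDerivAt_id x).const_mul 2).const_sub ω))
  refine h.congr_deriv ?_
  simp only [id]
  field_simp
  ring

lemma hasDerivAt_eta (ω χ ζ C : ℝ) {x : ℝ} (hx : x ≠ 0) (hxC : x + C ≠ 0) :
    HasDerivAt (eta ω χ ζ C)
      (Real.exp (-ω / x) / (x ^ 2 * (x + C) ^ 2) * F2 ω χ (ω * χ) (ω * χ * C) ζ x) x := by
  have h := (((hasDerivAt_exp_div (-ω) hx).const_mul χ).add_const ζ).div
    ((hasDerivAt_id x).add_const C) hxC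
  refine h.congr_deriv ?_
  have he : Real.exp (ω / x) * Real.exp (-(ω / x)) = 1 := by
    rw [← Real.exp_add, add_neg_cancel, Real.exp_zero]
  simp only [F2, id]
  field_simp
  linear_combination (ζ * x ^ 2) * he

lemma strictAntiOn_F2deriv (ω γ : ℝ) {χ ζ : ℝ} (hχ : 0 < χ) (hζ : 0 < ζ) :
    StrictAntiOn (F2deriv ω χ γ ζ) (Ioi 0) := by
  refine strictAntiOn_of_deriv_neg (convex_Ioi 0)
    (fun x hx => (hasDerivAt_F2deriv ω χ γ ζ (ne_of_gt hx)).continuousAt.continuousWithinAt)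
    fun x hx => ?_
  rw [interior_Ioi] at hx
  rw [(hasDerivAt_F2deriv ω χ γ ζ (ne_of_gt hx)).deriv]
  have : 0 ≤ ζ * Real.exp (ω / x) * ((x - ω) ^ 2 + x ^ 2) / x ^ 2 := by positivity
  linarith

lemma strictMonoOn_F2 {ω χ γ ζ β : ℝ} (μ : ℝ) (hχ : 0 < χ) (hζ : 0 < ζ) (hβ : 0 < β)
    (hβ0 : F2deriv ω χ γ ζ β = 0) : StrictMonoOn (F2 ω χ γ μ ζ) (Ioc 0 β) := by
  refine strictMonoOn_of_deriv_pos (convex_Ioc 0 β)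
    (fun x hx => (hasDerivAt_F2 ω χ γ μ ζ hx.1.ne').continuousAt.continuousWithinAt)
    fun x hx => ?_
  rw [interior_Ioc] at hx
  rw [(hasDerivAt_F2 ω χ γ μ ζ hx.1.ne').deriv, ← hβ0]
  exact strictAntiOn_F2deriv ω γ hχ hζ hx.1 hβ hx.2

lemma strictAntiOn_F2 {ω χ γ ζ β : ℝ} (μ : ℝ) (hχ : 0 < χ) (hζ : 0 < ζ) (hβ : 0 < β)
    (hβ0 : F2deriv ω χ γ ζ β = 0) : StrictAntiOn (F2 ω χ γ μ ζ) (Ici β) := by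
  refine strictAntiOn_of_deriv_neg (convex_Ici β)
    (fun x hx => (hasDerivAt_F2 ω χ γ μ ζ
      (hβ.trans_le hx).ne').continuousAt.continuousWithinAt)
    fun x hx => ?_
  rw [interior_Ici] at hx
  have hx0 : 0 < x := hβ.trans hx
  rw [(hasDerivAt_F2 ω χ γ μ ζ hx0.ne').deriv, ← hβ0]
  exact strictAntiOn_F2deriv ω γ hχ hζ hβ hx0 hx

lemma continuousOn_eta (ω χ ζ : ℝ) {C : ℝ} (hC : 0 < C) :
    ContinuousOn (eta ω χ ζ C) (Ioi 0) := fun _ hx =>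
  (hasDerivAt_eta ω χ ζ C (ne_of_gt hx)
    (add_pos hx hC).ne').continuousAt.continuousWithinAt

lemma deriv_eta (ω χ ζ : ℝ) {C x : ℝ} (hC : 0 < C) (hx : 0 < x) :
    deriv (eta ω χ ζ C) x =
      Real.exp (-ω / x) / (x ^ 2 * (x + C) ^ 2) * F2 ω χ (ω * χ) (ω * χ * C) ζ x :=
  (hasDerivAt_eta ω χ ζ C hx.ne' (add_pos hx hC).ne').deriv

lemma strictAntiOn_eta {ω χ ζ C : ℝ} (hC : 0 < C) {D : Set ℝ} (hD : Convex ℝ D)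
    (hD0 : D ⊆ Ioi 0) (hF : ∀ x ∈ interior D, F2 ω χ (ω * χ) (ω * χ * C) ζ x < 0) :
    StrictAntiOn (eta ω χ ζ C) D := by
  refine strictAntiOn_of_deriv_neg hD ((continuousOn_eta ω χ ζ hC).mono hD0) fun x hx => ?_
  have hx0 : 0 < x := hD0 (interior_subset hx)
  rw [deriv_eta ω χ ζ hC hx0]
  exact mul_neg_of_pos_of_neg (by positivity) (hF x hx)

lemma monotoneOn_eta {ω χ ζ C : ℝ} (hC : 0 < C) {D : Set ℝ} (hD : Convex ℝ D)
    (hD0 : D ⊆ Ioi 0) (hF : ∀ x ∈ interior D, 0 ≤ F2 ω χ (ω * χ) (ω * χ * C) ζ x) :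
    MonotoneOn (eta ω χ ζ C) D := by
  have hpos : ∀ x ∈ interior D, 0 < x := fun x hx => hD0 (interior_subset hx)
  refine monotoneOn_of_deriv_nonneg hD ((continuousOn_eta ω χ ζ hC).mono hD0)
    (fun x hx => (hasDerivAt_eta ω χ ζ C (hpos x hx).ne'
      (add_pos (hpos x hx) hC).ne').differentiableAt.differentiableWithinAt) fun x hx => ?_
  have hx0 := hpos x hx
  rw [deriv_eta ω χ ζ hC hx0]
  exact mul_nonneg (by positivity) (hF x hx)

lemma tendsto_eta_nhdsGT_zero {ω C : ℝ} (χ ζ : ℝ) (hω : 0 < ω) (hC : 0 < C) :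
    Tendsto (eta ω χ ζ C) (𝓝[>] 0) (𝓝 (ζ / C)) := by
  have hdiv : Tendsto (fun x : ℝ => -ω / x) (𝓝[>] 0) atBot := by
    simpa only [div_eq_mul_inv] using
      tendsto_inv_nhdsGT_zero.const_mul_atTop_of_neg (neg_neg_of_pos hω)
  have hnum : Tendsto (fun x : ℝ => χ * Real.exp (-ω / x) + ζ) (𝓝[>] 0) (𝓝 (χ * 0 + ζ)) :=
    ((Real.tendsto_exp_atBot.comp hdiv).const_mul χ).add_const ζ
  have hden : Tendsto (fun x : ℝ => x + C) (𝓝[>] 0) (𝓝 (0 + C)) :=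
    (tendsto_id.mono_left nhdsWithin_le_nhds).add_const C
  have h := hnum.div hden (by simpa using hC.ne')
  rw [mul_zero, zero_add, zero_add] at h
  exact h

lemma div_le_of_mem_upperBounds_eta {ω χ ζ C u : ℝ} (hω : 0 < ω) (hC : 0 < C)
    (hu : u ∈ upperBounds (eta ω χ ζ C '' Ioi 0)) : ζ / C ≤ u :=
  le_of_tendsto (tendsto_eta_nhdsGT_zero χ ζ hω hC) <|
    eventually_mem_nhdsWithin.mono fun _ hx => hu (mem_image_of_mem _ hx)

lemma eta_lt_div_of_F2_neg {ω χ ζ C P : ℝ} (hω : 0 < ω) (hC : 0 < C) (hP : 0 < P)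
    (hF : ∀ x ∈ Ioo 0 P, F2 ω χ (ω * χ) (ω * χ * C) ζ x < 0) : eta ω χ ζ C P < ζ / C := by
  have hanti : StrictAntiOn (eta ω χ ζ C) (Ioc 0 P) :=
    strictAntiOn_eta hC (convex_Ioc 0 P) (fun x hx => hx.1) (by rwa [interior_Ioc])
  have hhalf : P / 2 ∈ Ioc 0 P := ⟨by linarith, by linarith⟩
  refine (hanti hhalf ⟨hP, le_rfl⟩ (by linarith)).trans_le <|
    ge_of_tendsto (tendsto_eta_nhdsGT_zero χ ζ hω hC) ?_
  filter_upwards [Ioo_mem_nhdsGT hhalf.1] with x hx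
  exact (hanti ⟨hx.1, hx.2.le.trans hhalf.2⟩ hhalf hx.2).le

/-- Let `β` be the unique zero of `F₂'`. If `F₂(β) ≤ 0` then
`sup_{P>0} η(P) = ζ/C` and the supremum is not attained; if `F₂(β) > 0` and `α₂ > β`
is the larger zero of `F₂`, then `sup_{P>0} η(P) = max (ζ/C) (η(α₂))`. -/
theorem eta_sup (ω χ ζ C γ μ : ℝ)
    (hω : 0 < ω) (hχ : 0 < χ) (hζ : 0 < ζ) (hC : 0 < C)
    (hγ : γ = ω * χ) (hμ : μ = γ * C)
    (β : ℝ) (hβ : 0 < β) (hβ0 : F2deriv ω χ γ ζ β = 0)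
    (hβuniq : ∀ x : ℝ, 0 < x → F2deriv ω χ γ ζ x = 0 → x = β) :
    (F2 ω χ γ μ ζ β ≤ 0 →
      IsLUB (eta ω χ ζ C '' Set.Ioi 0) (ζ / C) ∧
      ∀ P, 0 < P → eta ω χ ζ C P ≠ ζ / C) ∧
    (∀ α₂ : ℝ, 0 < F2 ω χ γ μ ζ β → β < α₂ → F2 ω χ γ μ ζ α₂ = 0 →
      IsLUB (eta ω χ ζ C '' Set.Ioi 0) (max (ζ / C) (eta ω χ ζ C α₂))) := by
  subst hγ hμ
  have hmono := strictMonoOn_F2 (ω * χ * C) hχ hζ hβ hβ0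
  have hanti := strictAntiOn_F2 (ω * χ * C) hχ hζ hβ hβ0
  have hβmem : β ∈ Ioc 0 β := ⟨hβ, le_rfl⟩
  constructor
  · intro hF
    have hle : ∀ P, 0 < P → P ≤ β → eta ω χ ζ C P < ζ / C := fun P hP hPβ =>
      eta_lt_div_of_F2_neg hω hC hP fun x hx =>
        (hmono ⟨hx.1, hx.2.le.trans hPβ⟩ hβmem (hx.2.trans_le hPβ)).trans_le hF
    have hlt : ∀ P, 0 < P → eta ω χ ζ C P < ζ / C := by
      intro P hP
      rcases le_or_gt P β with hPβ | hβP
      · exact hle P hP hPβ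
      · refine (strictAntiOn_eta hC (convex_Ici β) (fun x hx => hβ.trans_le hx) ?_
          self_mem_Ici hβP.le hβP).trans (hle β hβ le_rfl)
        rw [interior_Ici]
        exact fun x hx => (hanti self_mem_Ici (mem_Ici_of_Ioi hx) hx).trans_le hF
    refine ⟨⟨?_, fun u hu => div_le_of_mem_upperBounds_eta hω hC hu⟩,
      fun P hP => (hlt P hP).ne⟩
    rintro _ ⟨P, hP, rfl⟩
    exact (hlt P hP).le
  · intro α hF hβα hα0
    have hα : 0 < α := hβ.trans hβα
    refine ⟨?_, fun u hu => max_le (div_le_of_mem_upperBounds_eta hω hC hu)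
      (hu (mem_image_of_mem _ hα))⟩
    rintro _ ⟨P, hP, rfl⟩
    rcases le_or_gt P α with hPα | hαP
    · rcases lt_or_ge (F2 ω χ (ω * χ) (ω * χ * C) ζ P) 0 with hneg | hnonneg
      · have hPβ : P < β := by
          by_contra! hβP
          exact (hneg.trans_eq hα0.symm).not_ge (hanti.antitoneOn hβP hβα.le hPα)
        refine le_max_of_le_left (eta_lt_div_of_F2_neg hω hC hP fun x hx => ?_).le
        exact (hmono ⟨hx.1, (hx.2.trans hPβ).le⟩ ⟨hP, hPβ.le⟩ hx.2).trans hneg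
      · refine le_max_of_le_right (monotoneOn_eta hC (convex_Icc P α)
          (fun x hx => lt_of_lt_of_le hP hx.1) ?_ ⟨le_rfl, hPα⟩ ⟨hPα, le_rfl⟩ hPα)
        rw [interior_Icc]
        intro x hx
        rcases le_total x β with hxβ | hβx
        · exact hnonneg.trans (hmono.monotoneOn ⟨hP, hx.1.le.trans hxβ⟩
            ⟨lt_trans hP hx.1, hxβ⟩ hx.1.le)
        · exact hα0.symm.le.trans (hanti.antitoneOn hβx hβα.le hx.2.le)
    · refine le_max_of_le_right (strictAntiOn_eta hC (convex_Ici α)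
        (fun x hx => hα.trans_le hx) ?_ self_mem_Ici hαP.le hαP).le
      rw [interior_Ici]
      exact fun x hx => (hanti hβα.le (hβα.trans hx).le hx).trans_eq hα0
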